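/- Let G be a finite connected simple graph with boundary B and injective boundary values u : B → ℝ as in the context, let σ be an orientation of G compatible with u, and let 𝓔 : E → ℝ assign a positive real energy to each edge. Then the function h ↦ Σ_{e} 𝓔_e · log(h(x_e) − h(y_e)), where the sum is over edges e directed from x_e to y_e by σ, attains its maximum over F_u(σ) at a unique point h*, and h* satisfies the enharmonic equation Σ_{y ∼ x} 𝓔_{xy}/(h*(x) − h*(y)) = 0 at every interior vertex x. -/

import Mathlib

attribute [local instance] Classical.propDecidable

structure GraphOrientation {V : Type*} (G : SimpleGraph V) where
  dir : V → V → Prop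
  dir_adj : ∀ x y, dir x y → G.Adj x y
  dir_total : ∀ x y, G.Adj x y → (dir x y ↔ ¬ dir y x)

variable {V : Type*} [Fintype V] [DecidableEq V]

/-- σ is compatible with boundary values u. -/
def Compatible (G : SimpleGraph V) (B : Set V) (u : V → ℝ) (σ : GraphOrientation G) : Prop :=
  (∀ x, ¬ Relation.TransGen σ.dir x x) ∧
  (∀ x, x ∉ B → (∃ y, σ.dir x y) ∧ (∃ y, σ.dir y x)) ∧
  (∀ a ∈ B, ∀ b ∈ B, Relation.TransGen σ.dir a b → u b < u a)

/-- B has ≥ 2 vertices and every edge lies on a simple path between distinct boundary vertices. -/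
def BoundaryOK (G : SimpleGraph V) (B : Set V) : Prop :=
  2 ≤ B.ncard ∧ ∀ e ∈ G.edgeSet, ∃ a ∈ B, ∃ b ∈ B, a ≠ b ∧
    ∃ p : G.Walk a b, p.IsPath ∧ e ∈ p.edges

/-- h is c-harmonic at each interior vertex. -/
def Harmonic (G : SimpleGraph V) (B : Set V) (c : Sym2 V → ℝ) (h : V → ℝ) : Prop :=
  ∀ x, x ∉ B → ∑ y ∈ G.neighborFinset x, c s(x, y) * (h x - h y) = 0

/-- the enharmonic (fixed-energy) equation at x. -/
def EnharmonicAt (G : SimpleGraph V) (𝓔 : Sym2 V → ℝ) (h : V → ℝ) (x : V) : Prop :=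
  ∑ y ∈ G.neighborFinset x, 𝓔 s(x, y) / (h x - h y) = 0

/-- the polytope of functions extending u and strictly decreasing along σ. -/
def FuSigma (G : SimpleGraph V) (B : Set V) (u : V → ℝ) (σ : GraphOrientation G) : Set (V → ℝ) :=
  {h | (∀ b ∈ B, h b = u b) ∧ ∀ x y, σ.dir x y → h y < h x}

noncomputable def LogM (G : SimpleGraph V) (σ : GraphOrientation G) (𝓔 : Sym2 V → ℝ)
    (h : V → ℝ) : ℝ :=
  ∑ p ∈ Finset.univ.filter (fun p : V × V => σ.dir p.1 p.2),
    𝓔 s(p.1, p.2) * Real.log (h p.1 - h p.2)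

noncomputable def Mfun (G : SimpleGraph V) (𝓔 : Sym2 V → ℝ) (h : V → ℝ) : ℝ :=
  ∏ e ∈ G.edgeFinset,
    Sym2.lift ⟨fun x y => |h x - h y| ^ 𝓔 s(x, y),
      by intro x y; simp only []; rw [abs_sub_comm, Sym2.eq_swap]⟩ e

lemma aux_nonempty (G : SimpleGraph V)
    (B : Set V) (u : V → ℝ)
    (σ : GraphOrientation G) (hσ : Compatible G B u σ) : ∃ h, h ∈ FuSigma G B u σ := by
  obtain ⟨hac, hint, hcomp⟩ := hσ
  obtain ⟨C, hC⟩ : ∃ C : ℝ, ∀ x, C < u x := by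
    obtain ⟨C, hC⟩ := (Set.finite_range u).bddBelow
    exact ⟨C - 1, fun x => by have := hC (Set.mem_range_self x); linarith⟩
  let f : V → ℝ := fun y => if y ∈ B then u y else C
  let R : V → Finset V := fun x => Finset.univ.filter (fun y => Relation.ReflTransGen σ.dir x y)
  have hR : ∀ x, (R x).Nonempty := fun x => ⟨x, by simp [R, Relation.ReflTransGen.refl]⟩
  let L : V → ℝ := fun x => (R x).sup' (hR x) f
  let d : V → ℕ := fun x => (Finset.univ.filter (fun y => Relation.TransGen σ.dir x y)).card
  have hL : ∀ x y, σ.dir x y → L y ≤ L x := by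
    intro x y hxy
    apply Finset.sup'_mono
    intro z hz
    simp only [R, Finset.mem_filter, Finset.mem_univ, true_and] at hz ⊢
    exact Relation.ReflTransGen.head hxy hz
  have hd : ∀ x y, σ.dir x y → d y < d x := by
    intro x y hxy
    apply Finset.card_lt_card
    rw [Finset.ssubset_iff_of_subset]
    · exact ⟨y, by simp [Relation.TransGen.single hxy], by simp [hac y]⟩
    · intro z hz
      simp only [Finset.mem_filter, Finset.mem_univ, true_and] at hz ⊢
      exact Relation.TransGen.head hxy hz
  have hLB : ∀ x y, x ∈ B → σ.dir x y → L y < u x := by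
    intro x y hx hxy
    simp only [L]
    rw [Finset.sup'_lt_iff]
    intro z hz
    simp only [R, Finset.mem_filter, Finset.mem_univ, true_and] at hz
    simp only [f]
    split_ifs with hzB
    · exact hcomp x hx z hzB (Relation.TransGen.head' hxy hz)
    · exact hC x
  have hLu : ∀ x y, y ∈ B → σ.dir x y → u y ≤ L x := by
    intro x y hy hxy
    have : f y ≤ L x := Finset.le_sup' f (by
      simp only [R, Finset.mem_filter, Finset.mem_univ, true_and]
      exact Relation.ReflTransGen.single hxy)
    simpa [f, hy] using this
  have hev : ∀ᶠ ε in nhdsWithin (0:ℝ) (Set.Ioi 0), ∀ x y, x ∈ B → σ.dir x y →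
      L y + ε * (d y + 1) < u x := by
    rw [Filter.eventually_all]; intro x
    rw [Filter.eventually_all]; intro y
    by_cases hx : x ∈ B
    · by_cases hxy : σ.dir x y
      · have : Filter.Tendsto (fun ε : ℝ => L y + ε * (d y + 1)) (nhds 0) (nhds (L y + 0 * (d y + 1))) :=
          (Continuous.tendsto (by fun_prop) 0)
        have h2 : L y + 0 * ((d y : ℝ) + 1) < u x := by simpa using hLB x y hx hxy
        filter_upwards [(this.mono_left nhdsWithin_le_nhds).eventually_lt_const h2] with ε hε _ _
        exact hε
      · simp [hxy]
    · simp [hx]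
  obtain ⟨ε, hε, hε0⟩ := (hev.and self_mem_nhdsWithin).exists
  have hε0 : 0 < ε := hε0
  refine ⟨fun x => if x ∈ B then u x else L x + ε * (d x + 1), fun b hb => by simp [hb], ?_⟩
  intro x y hxy
  by_cases hx : x ∈ B <;> by_cases hy : y ∈ B <;> simp only [hx, hy, if_true, if_false]
  · exact hcomp x hx y hy (Relation.TransGen.single hxy)
  · exact hε x y hx hxy
  · have := hLu x y hy hxy
    have : 0 < ε * ((d x : ℝ) + 1) := by positivity
    linarith
  · have h1 := hL x y hxy
    have h2 : (d y : ℝ) < d x := by exact_mod_cast hd x y hxy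
    have := mul_lt_mul_of_pos_left h2 hε0
    linarith

lemma aux_bdd (G : SimpleGraph V) (B : Set V) (u : V → ℝ) (C : ℝ) (hC : ∀ b, |u b| ≤ C)
    (σ : GraphOrientation G) (hσ : Compatible G B u σ) (h : V → ℝ) (hh : h ∈ FuSigma G B u σ)
    (x : V) : h x ∈ Set.Icc (-C) C := by
  obtain ⟨hac, hint, hcomp⟩ := hσ
  haveI : Nonempty V := ⟨x⟩
  constructor
  · obtain ⟨z, hz⟩ := Finite.exists_min h
    by_cases hzB : z ∈ B
    · have h1 := hh.1 z hzB
      have h2 := abs_le.1 (hC z)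
      linarith [hz x]
    · obtain ⟨⟨y, hy⟩, _⟩ := hint z hzB
      exact absurd (hh.2 _ _ hy) (not_lt.2 (hz y))
  · obtain ⟨z, hz⟩ := Finite.exists_max h
    by_cases hzB : z ∈ B
    · have h1 := hh.1 z hzB
      have h2 := abs_le.1 (hC z)
      linarith [hz x]
    · obtain ⟨_, ⟨y, hy⟩⟩ := hint z hzB
      exact absurd (hh.2 _ _ hy) (not_lt.2 (hz y))

lemma aux_exists (G : SimpleGraph V)
    (B : Set V) (u : V → ℝ)
    (σ : GraphOrientation G) (hσ : Compatible G B u σ)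
    (𝓔 : Sym2 V → ℝ) (h𝓔 : ∀ e ∈ G.edgeSet, 0 < 𝓔 e) :
    ∃ hstar ∈ FuSigma G B u σ,
      (∀ h ∈ FuSigma G B u σ, LogM G σ 𝓔 h ≤ LogM G σ 𝓔 hstar) := by
  obtain ⟨h0, hh0⟩ := aux_nonempty G B u σ hσ
  obtain ⟨C, hC⟩ : ∃ C : ℝ, ∀ b, |u b| ≤ C := by
    obtain ⟨C, hC⟩ := (Set.finite_range (fun b => |u b|)).bddAbove
    exact ⟨C, fun x => hC (Set.mem_range_self x)⟩
  have hE : ∀ x y, σ.dir x y → 0 < 𝓔 s(x, y) := fun x y hxy =>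
    h𝓔 _ (by simpa using σ.dir_adj x y hxy)
  let S : Finset (V × V) := Finset.univ.filter (fun p : V × V => σ.dir p.1 p.2)
  have hS : ∀ p, p ∈ S ↔ σ.dir p.1 p.2 := fun p => by simp [S]
  let P : (V → ℝ) → ℝ := fun h => ∏ p ∈ S, (h p.1 - h p.2) ^ 𝓔 s(p.1, p.2)
  have hPc : Continuous P := by
    apply continuous_finsetProd
    intro p hp
    apply Continuous.rpow_const (by fun_prop)
    intro h
    exact Or.inr (hE _ _ ((hS p).1 hp)).le
  let K : Set (V → ℝ) := (Set.univ.pi fun _ => Set.Icc (-C) C) ∩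
    {h | (∀ b ∈ B, h b = u b) ∧ ∀ x y, σ.dir x y → h y ≤ h x}
  have hK : IsCompact K := by
    apply (isCompact_univ_pi fun _ => isCompact_Icc).inter_right
    simp only [Set.setOf_and, Set.setOf_forall]
    apply IsClosed.inter
    · exact isClosed_iInter fun b => isClosed_iInter fun _ =>
        isClosed_eq (by fun_prop) (by fun_prop)
    · exact isClosed_iInter fun b => isClosed_iInter fun _ => isClosed_iInter fun _ =>
        isClosed_le (by fun_prop) (by fun_prop)
  have hFK : ∀ h ∈ FuSigma G B u σ, h ∈ K := fun h hh =>
    ⟨fun x _ => aux_bdd G B u C hC σ hσ h hh x, hh.1, fun x y hxy => (hh.2 x y hxy).le⟩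
  have hPpos : ∀ h ∈ FuSigma G B u σ, 0 < P h := fun h hh =>
    Finset.prod_pos fun p hp => Real.rpow_pos_of_pos (sub_pos.2 (hh.2 _ _ ((hS p).1 hp))) _
  have hlog : ∀ h ∈ FuSigma G B u σ, Real.log (P h) = LogM G σ 𝓔 h := by
    intro h hh
    have hpos : ∀ p ∈ S, 0 < h p.1 - h p.2 := fun p hp =>
      sub_pos.2 (hh.2 _ _ ((hS p).1 hp))
    simp only [P, LogM]
    rw [Real.log_prod (fun p hp => (Real.rpow_pos_of_pos (hpos p hp) _).ne')]
    exact Finset.sum_congr rfl fun p hp => Real.log_rpow (hpos p hp) _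
  obtain ⟨k, hkK, hk⟩ := hK.exists_isMaxOn ⟨h0, hFK h0 hh0⟩ hPc.continuousOn
  have hkpos : 0 < P k := lt_of_lt_of_le (hPpos h0 hh0) (hk (hFK h0 hh0))
  have hkF : k ∈ FuSigma G B u σ := by
    refine ⟨hkK.2.1, fun x y hxy => lt_of_le_of_ne (hkK.2.2 x y hxy) fun heq => ?_⟩
    have : P k = 0 := Finset.prod_eq_zero ((hS (x, y)).2 hxy) (by
      simp [heq, Real.zero_rpow (hE x y hxy).ne'])
    linarith
  refine ⟨k, hkF, fun h hh => ?_⟩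
  rw [← hlog h hh, ← hlog k hkF]
  exact Real.log_le_log (hPpos h hh) (hk (hFK h hh))

lemma aux_log {a b : ℝ} (ha : 0 < a) (hb : 0 < b) (hab : a ≠ b) :
    (Real.log a + Real.log b) / 2 < Real.log ((a + b) / 2) := by
  have := strictConcaveOn_log_Ioi.2 (Set.mem_Ioi.2 ha) (Set.mem_Ioi.2 hb) hab (show (0:ℝ) < 1/2 by norm_num) (show (0:ℝ) < 1/2 by norm_num) (by norm_num)
  simp only [smul_eq_mul] at this
  rw [show (a + b) / 2 = 1/2 * a + 1/2 * b by ring]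
  linarith

lemma aux_unique (G : SimpleGraph V) (hconn : G.Connected)
    (B : Set V) (hB : BoundaryOK G B) (u : V → ℝ)
    (σ : GraphOrientation G)
    (𝓔 : Sym2 V → ℝ) (h𝓔 : ∀ e ∈ G.edgeSet, 0 < 𝓔 e)
    (h k : V → ℝ) (hh : h ∈ FuSigma G B u σ) (hk : k ∈ FuSigma G B u σ)
    (hmax : ∀ h' ∈ FuSigma G B u σ, LogM G σ 𝓔 h' ≤ LogM G σ 𝓔 h)
    (kmax : ∀ h' ∈ FuSigma G B u σ, LogM G σ 𝓔 h' ≤ LogM G σ 𝓔 k) : h = k := by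
  have hE : ∀ x y, σ.dir x y → 0 < 𝓔 s(x, y) := fun x y hxy =>
    h𝓔 _ (by simpa using σ.dir_adj x y hxy)
  have key : ∀ x y, σ.dir x y → h x - h y = k x - k y := by
    by_contra! hcon
    obtain ⟨x, y, hxy, hne⟩ := hcon
    let m : V → ℝ := fun v => (h v + k v) / 2
    have hm : m ∈ FuSigma G B u σ := by
      refine ⟨fun b hb => ?_, fun a b hab => ?_⟩
      · simp only [m, hh.1 b hb, hk.1 b hb]; ring
      · have := hh.2 _ _ hab
        have := hk.2 _ _ hab
        simp only [m]; linarith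
    have hlt : (LogM G σ 𝓔 h + LogM G σ 𝓔 k) / 2 < LogM G σ 𝓔 m := by
      simp only [LogM]
      rw [← Finset.sum_add_distrib, Finset.sum_div]
      have hs : ∀ a b, σ.dir a b → h a - h b ≠ k a - k b →
          (𝓔 s(a, b) * Real.log (h a - h b) + 𝓔 s(a, b) * Real.log (k a - k b)) / 2
            < 𝓔 s(a, b) * Real.log (m a - m b) := by
        intro a b hab hn
        have := mul_lt_mul_of_pos_left (aux_log (sub_pos.2 (hh.2 _ _ hab))
          (sub_pos.2 (hk.2 _ _ hab)) hn) (hE a b hab)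
        rw [show m a - m b = (h a - h b + (k a - k b)) / 2 by simp only [m]; ring]
        linarith
      apply Finset.sum_lt_sum
      · rintro ⟨a, b⟩ hp
        simp only [Finset.mem_filter, Finset.mem_univ, true_and] at hp
        by_cases hn : h a - h b = k a - k b
        · have : m a - m b = k a - k b := by simp only [m]; linarith
          simp only [hn, this]; linarith
        · exact (hs a b hp hn).le
      · exact ⟨(x, y), by simpa using hxy, hs x y hxy hne⟩
    have := hmax m hm
    have := kmax m hm
    linarith
  have hadj : ∀ x y, G.Adj x y → h x - k x = h y - k y := by
    intro x y hxy
    by_cases hd : σ.dir x y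
    · linarith [key x y hd]
    · have : σ.dir y x := by
        by_contra hc
        exact hd ((σ.dir_total x y hxy).2 hc)
      linarith [key y x this]
  have hreach : ∀ x y, G.Reachable x y → h x - k x = h y - k y := by
    rintro x y ⟨w⟩
    induction w with
    | nil => rfl
    | cons ha _ ih => exact (hadj _ _ ha).trans ih
  have hBne : B.Nonempty := by
    apply Set.nonempty_of_ncard_ne_zero
    have := hB.1
    omega
  obtain ⟨b, hb⟩ := hBne
  funext x
  have h1 := hreach x b (hconn.preconnected x b)
  have h2 := hh.1 b hb
  have h3 := hk.1 b hb
  linarith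

lemma aux_enh (G : SimpleGraph V)
    (B : Set V) (u : V → ℝ)
    (σ : GraphOrientation G)
    (𝓔 : Sym2 V → ℝ)
    (h : V → ℝ) (hh : h ∈ FuSigma G B u σ)
    (hmax : ∀ h' ∈ FuSigma G B u σ, LogM G σ 𝓔 h' ≤ LogM G σ 𝓔 h)
    (x : V) (hx : x ∉ B) : EnharmonicAt G 𝓔 h x := by
  let e : V → ℝ := fun v => if v = x then 1 else 0
  let g : ℝ → V → ℝ := fun t v => h v + t * e v
  have g0 : g 0 = h := by funext v; simp [g]
  have hev : ∀ᶠ t in nhds (0:ℝ), g t ∈ FuSigma G B u σ := by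
    have : ∀ᶠ t in nhds (0:ℝ), ∀ a b, σ.dir a b → g t b < g t a := by
      rw [Filter.eventually_all]; intro a
      rw [Filter.eventually_all]; intro b
      by_cases hab : σ.dir a b
      · have h1 : ContinuousAt (fun t => g t b) 0 := by simp only [g]; fun_prop
        have h2 : ContinuousAt (fun t => g t a) 0 := by simp only [g]; fun_prop
        filter_upwards [h1.eventually_lt h2 (by simpa [g0] using hh.2 a b hab)] with t ht _
        exact ht
      · simp [hab]
    filter_upwards [this] with t ht
    refine ⟨fun b hb => ?_, ht⟩
    have : b ≠ x := fun hbx => hx (hbx ▸ hb)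
    simp [g, e, this, hh.1 b hb]
  have hloc : IsLocalMax (fun t => LogM G σ 𝓔 (g t)) 0 := by
    filter_upwards [hev] with t ht
    simp only [g0]
    exact hmax _ ht
  have hder : HasDerivAt (fun t => LogM G σ 𝓔 (g t))
      (∑ p ∈ Finset.univ.filter (fun p : V × V => σ.dir p.1 p.2),
        𝓔 s(p.1, p.2) * ((e p.1 - e p.2) / (h p.1 - h p.2))) 0 := by
    simp only [LogM]
    apply HasDerivAt.fun_sum
    rintro ⟨a, b⟩ hp
    simp only [Finset.mem_filter, Finset.mem_univ, true_and] at hp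
    apply HasDerivAt.const_mul
    have hg : ∀ v, HasDerivAt (fun t => g t v) (e v) 0 := by
      intro v
      simpa [g] using ((hasDerivAt_id (0:ℝ)).mul_const (e v)).const_add (h v)
    have := ((hg a).sub (hg b)).log (by
      simp [g0, sub_ne_zero, (hh.2 _ _ hp).ne'])
    simpa [g0] using this
  have hz := hloc.hasDerivAt_eq_zero hder
  rw [Finset.sum_filter, Fintype.sum_prod_type] at hz
  unfold EnharmonicAt
  rw [← hz]
  have e1 : ∀ a b, (if σ.dir a b then 𝓔 s(a, b) * ((e a - e b) / (h a - h b)) else 0)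
      = (if a = x then (if σ.dir a b then 𝓔 s(a, b) / (h a - h b) else 0) else 0)
      + (if b = x then (if σ.dir a b then 𝓔 s(a, b) / (h b - h a) else 0) else 0) := by
    intro a b
    by_cases hab : σ.dir a b
    · have h1 : h a - h b ≠ 0 := by simp [sub_ne_zero, (hh.2 _ _ hab).ne']
      rw [show h b - h a = -(h a - h b) by ring]
      simp only [hab, if_true, e, div_neg]
      split_ifs <;> ring
    · simp [hab]
  simp only [e1, Finset.sum_add_distrib]
  rw [Finset.sum_comm]
  simp only [Finset.sum_ite_eq', Finset.mem_univ, if_true]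
  rw [← Finset.sum_add_distrib, SimpleGraph.neighborFinset_eq_filter, Finset.sum_filter]
  apply Finset.sum_congr rfl
  intro y _
  by_cases hxy : G.Adj x y
  · have := σ.dir_total x y hxy
    by_cases hd : σ.dir x y
    · have h2 := this.1 hd
      simp [hxy, hd, h2]
    · have h2 : σ.dir y x := by
        by_contra hc
        exact hd (this.2 hc)
      simp [hxy, hd, h2, Sym2.eq_swap]
  · have h1 : ¬ σ.dir x y := fun hd => hxy (σ.dir_adj _ _ hd)
    have h2 : ¬ σ.dir y x := fun hd => hxy (σ.dir_adj _ _ hd).symm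
    simp [hxy, h1, h2]

/-- the functional h ↦ Σ_e 𝓔_e log(h x_e - h y_e) attains its maximum on F_u(σ)
at a unique point, which satisfies the enharmonic equation at every interior vertex. -/
theorem stmt_1 (G : SimpleGraph V) (hconn : G.Connected)
    (B : Set V) (hB : BoundaryOK G B) (u : V → ℝ) (hu : Set.InjOn u B)
    (σ : GraphOrientation G) (hσ : Compatible G B u σ)
    (𝓔 : Sym2 V → ℝ) (h𝓔 : ∀ e ∈ G.edgeSet, 0 < 𝓔 e) :
    ∃ hstar ∈ FuSigma G B u σ,
      (∀ h ∈ FuSigma G B u σ, LogM G σ 𝓔 h ≤ LogM G σ 𝓔 hstar) ∧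
      (∀ h ∈ FuSigma G B u σ,
        (∀ h' ∈ FuSigma G B u σ, LogM G σ 𝓔 h' ≤ LogM G σ 𝓔 h) → h = hstar) ∧
      (∀ x, x ∉ B → EnharmonicAt G 𝓔 hstar x) := by
  obtain ⟨k, hkF, hk⟩ := aux_exists G B u σ hσ 𝓔 h𝓔
  exact ⟨k, hkF, hk, fun h hh hm => aux_unique G hconn B hB u σ 𝓔 h𝓔 h k hh hkF hm hk,
    fun x hx => aux_enh G B u σ 𝓔 k hkF hk x hx⟩
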